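/- Let (R_i)_{i ∈ I} be a family of rings and R a subring of the product ∏_{i ∈ I} R_i, with π_i : R → R_i the coordinate projections. Let n ≥ 2 and m ≥ 1, let (i_{j,k})_{j<n, k<m} be pairwise distinct elements of I, and let r_{j,k} ∈ R_{i_{j,k}} satisfy r_{j,k}^n ≠ 0. Suppose s_{j,k} ∈ R are elements with π_{i_{j,k}}(s_{j,k}) = r_{j,k} and π_{i_{j',k'}}(s_{j,k}) = 0 whenever (j',k') ≠ (j,k). Put b_j = Σ_{j' < n, j' ≠ j} Σ_{k < m} s_{j',k} for j < n, and let J(b_j) denote the two-sided ideal of R generated by b_j. Then for every j₀ < n, the additive index of ⋂_{j < n} J(b_j) in ⋂_{j < n, j ≠ j₀} J(b_j) is at least m. -/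

import Mathlib

namespace Stmt18

/-- `nupow x n = x^n` for `n ≥ 1` in a possibly non-unital ring (`nupow x 0 = 0` is junk). -/
def nupow {A : Type*} [NonUnitalRing A] (x : A) : ℕ → A
  | 0 => 0
  | 1 => x
  | (k+2) => nupow x (k+1) * x

/-- The two-sided ideal generated by `b`: the smallest additive subgroup containing `b`
which is closed under left and right multiplication by arbitrary elements. -/
def idealGen {A : Type*} [NonUnitalRing A] (b : A) : AddSubgroup A :=
  sInf {S : AddSubgroup A | b ∈ S ∧ ∀ x ∈ S, ∀ r : A, r * x ∈ S ∧ x * r ∈ S}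

theorem nupow_left {A : Type*} [NonUnitalRing A] (x : A) (k : ℕ) :
    x * nupow x (k+1) = nupow x (k+2) := by
  induction k with
  | zero => rfl
  | succ k ih =>
    change x * (nupow x (k+1) * x) = nupow x (k+2) * x
    rw [← mul_assoc, ih]

theorem idealGen_self {A : Type*} [NonUnitalRing A] (b : A) : b ∈ idealGen b := by
  rw [idealGen, AddSubgroup.mem_sInf]
  exact fun S hS => hS.1

theorem idealGen_mul {A : Type*} [NonUnitalRing A] (b x r : A) (hx : x ∈ idealGen b) :
    r * x ∈ idealGen b ∧ x * r ∈ idealGen b := by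
  rw [idealGen, AddSubgroup.mem_sInf] at *
  rw [AddSubgroup.mem_sInf]
  exact ⟨fun S hS => (hS.2 x (hx S hS) r).1, fun S hS => (hS.2 x (hx S hS) r).2⟩

/-- The product of the `b j`, `j ∈ L`, followed by `a`. -/
def lprod {A J : Type*} [NonUnitalRing A] (b : J → A) (a : A) : List J → A
  | [] => a
  | j :: L => b j * lprod b a L

theorem lprod_mem {A J : Type*} [NonUnitalRing A] (b : J → A) (a : A) (L : List J) (j : J)
    (hj : j ∈ L) : lprod b a L ∈ idealGen (b j) := by
  induction L with
  | nil => simp at hj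
  | cons i L ih =>
    rcases List.mem_cons.1 hj with rfl | h
    · exact (idealGen_mul _ _ _ (idealGen_self _)).2
    · exact (idealGen_mul _ _ _ (ih h)).1

theorem lprod_zero {A B J : Type*} [NonUnitalRing A] [NonUnitalRing B] (f : A →ₙ+* B)
    (b : J → A) (a : A) (L : List J) (ha : f a = 0) : f (lprod b a L) = 0 := by
  induction L with
  | nil => exact ha
  | cons i L ih => rw [lprod, map_mul, ih, mul_zero]

theorem lprod_pow {A B J : Type*} [NonUnitalRing A] [NonUnitalRing B] (f : A →ₙ+* B)
    (b : J → A) (a : A) (x : B) (L : List J) (ha : f a = x) (hb : ∀ j ∈ L, f (b j) = x) :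
    f (lprod b a L) = nupow x (L.length + 1) := by
  induction L with
  | nil => exact ha
  | cons i L ih =>
    rw [lprod, map_mul, ih fun j hj => hb j (List.mem_cons_of_mem _ hj), hb i (by simp),
      nupow_left]
    rfl

theorem idealGen_zero {A B : Type*} [NonUnitalRing A] [NonUnitalRing B] (f : A →ₙ+* B)
    (b x : A) (hb : f b = 0) (hx : x ∈ idealGen b) : f x = 0 := by
  rw [idealGen, AddSubgroup.mem_sInf] at hx
  refine hx (f : A →+ B).ker ⟨hb, fun y hy r => ?_⟩
  have hy' : f y = 0 := hy
  constructor
  · change f (r * y) = 0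
    rw [map_mul, hy', mul_zero]
  · change f (y * r) = 0
    rw [map_mul, hy', zero_mul]

theorem ideal_intersection_index {ι : Type*} (Ri : ι → Type*)
    [∀ i, NonUnitalRing (Ri i)] (R : NonUnitalSubring (∀ i, Ri i))
    (n m : ℕ) (hn : 2 ≤ n) (hm : 1 ≤ m)
    (idx : Fin n → Fin m → ι)
    (hidx : Function.Injective (fun p : Fin n × Fin m => idx p.1 p.2))
    (r : ∀ (j : Fin n) (k : Fin m), Ri (idx j k))
    (hr : ∀ j k, nupow (r j k) n ≠ 0)
    (s : ∀ (_ : Fin n) (_ : Fin m), R)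
    (hs1 : ∀ j k, (s j k : ∀ i, Ri i) (idx j k) = r j k)
    (hs2 : ∀ j k j' k', (j, k) ≠ (j', k') → (s j k : ∀ i, Ri i) (idx j' k') = 0)
    (b : Fin n → R)
    (hb : ∀ j, b j = ∑ j' ∈ Finset.univ.erase j, ∑ k : Fin m, s j' k) :
    ∀ j₀ : Fin n, ∃ t : Fin m → R,
      (∀ k, ∀ j, j ≠ j₀ → t k ∈ idealGen (b j)) ∧
      (∀ k k', k ≠ k' → ∃ j : Fin n, t k - t k' ∉ idealGen (b j)) := by
  classical
  intro j₀
  let ev : ∀ i, R →ₙ+* Ri i := fun i =>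
    (Pi.evalNonUnitalRingHom Ri i).comp (NonUnitalSubringClass.subtype R)
  have hev1 : ∀ j k, ev (idx j k) (s j k) = r j k := hs1
  have hev2 : ∀ j k j' k', (j, k) ≠ (j', k') → ev (idx j' k') (s j k) = 0 := hs2
  have hb0 : ∀ j k, ev (idx j k) (b j) = 0 := by
    intro j k
    rw [hb, map_sum]
    refine Finset.sum_eq_zero fun j' hj' => ?_
    rw [map_sum]
    refine Finset.sum_eq_zero fun k' _ => hev2 _ _ _ _ fun h => ?_
    exact (Finset.mem_erase.1 hj').1 (Prod.ext_iff.1 h).1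
  have hb1 : ∀ j j' k, j ≠ j' → ev (idx j k) (b j') = r j k := by
    intro j j' k hne
    rw [hb, map_sum, Finset.sum_eq_single j, map_sum, Finset.sum_eq_single k, hev1]
    · exact fun k' _ hk => hev2 _ _ _ _ fun h => hk (Prod.ext_iff.1 h).2
    · simp
    · intro i _ hi
      rw [map_sum]
      exact Finset.sum_eq_zero fun k' _ => hev2 _ _ _ _ fun h => hi (Prod.ext_iff.1 h).1
    · intro h
      exact absurd (Finset.mem_erase.2 ⟨hne, Finset.mem_univ _⟩) h
  let L : List (Fin n) := (Finset.univ.erase j₀).toList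
  have hL : L.length + 1 = n := by
    simp only [L, Finset.length_toList, Finset.card_erase_of_mem (Finset.mem_univ j₀),
      Finset.card_univ, Fintype.card_fin]
    omega
  refine ⟨fun k => lprod b (s j₀ k) L, fun k j hj => lprod_mem _ _ _ _ (by simp [L, hj]),
    fun k k' hk => ⟨j₀, fun hmem => hr j₀ k ?_⟩⟩
  have h0 := idealGen_zero (ev (idx j₀ k)) _ _ (hb0 j₀ k) hmem
  rw [map_sub, lprod_zero (ev (idx j₀ k)) b (s j₀ k') L
      (hev2 _ _ _ _ fun h => hk (Prod.ext_iff.1 h).2.symm), sub_zero,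
    lprod_pow (ev (idx j₀ k)) b (s j₀ k) (r j₀ k) L (hev1 _ _) (fun j hj => hb1 _ _ _ ?_),
    hL] at h0
  · exact h0
  · have : j ≠ j₀ := by simpa [L] using hj
    exact this.symm

end Stmt18
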